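/- T_{max,2}(35) = 169, T_{max,3}(35) = 225, T_{max,4}(35) = 279, and T_{max,5}(35) = 315; in particular, for l = 35 the function m1 ↦ T_{max,m1}(35) is strictly increasing on {1, 2, 3, 4, 5}, and its maximum 315 is attained at m1 = 5, consistent with the Briançon–Iarrobino prediction that the maximal ideal power 𝔪^5 (of colength 35 = binomial(7,3)) gives the most singular point of Hilb^35(𝔸^3). -/

import Mathlib

open MvPolynomial

/-- A monomial ideal: an ideal containing the monomials of all its elements. -/
def IsMonomialIdeal (I : Ideal (MvPolynomial (Fin 3) ℂ)) : Prop :=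
  ∀ p ∈ I, ∀ d ∈ p.support, (monomial d (1 : ℂ)) ∈ I

/-- Borel-fixed (strongly stable) in characteristic 0: for every monomial in `I`
divisible by `x_j`, and every `i < j`, replacing one factor `x_j` by `x_i`
stays in `I`. -/
def IsBorelFixed (I : Ideal (MvPolynomial (Fin 3) ℂ)) : Prop :=
  ∀ d : Fin 3 →₀ ℕ, (monomial d (1 : ℂ)) ∈ I →
    ∀ i j : Fin 3, i < j → 0 < d j →
      (monomial (d + Finsupp.single i 1 - Finsupp.single j 1) (1 : ℂ)) ∈ I

/-- The dimension of the tangent space to the Hilbert scheme at `[I]`,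
namely `dim_ℂ Hom_R(I, R/I)`. -/
noncomputable def tangentDim (I : Ideal (MvPolynomial (Fin 3) ℂ)) : ℕ :=
  Module.finrank ℂ (↥I →ₗ[MvPolynomial (Fin 3) ℂ] (MvPolynomial (Fin 3) ℂ ⧸ I))

/-- `TmaxEq l m1 T` says that `T` is the maximum of `dim_ℂ Hom_R(I, R/I)` over all
Borel-fixed monomial ideals `I ⊆ ℂ[x,y,z]` of colength `l` whose smallest pure power
of `x` lying in `I` is `x^{m1}`. -/
def TmaxEq (l m1 T : ℕ) : Prop :=
  IsGreatest { t : ℕ | ∃ I : Ideal (MvPolynomial (Fin 3) ℂ),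
      IsMonomialIdeal I ∧ IsBorelFixed I ∧
      Module.finrank ℂ (MvPolynomial (Fin 3) ℂ ⧸ I) = l ∧
      (X 0 : MvPolynomial (Fin 3) ℂ) ^ m1 ∈ I ∧
      (X 0 : MvPolynomial (Fin 3) ℂ) ^ (m1 - 1) ∉ I ∧
      t = tangentDim I } T

namespace BorelTangent

theorem mem_of_support {I : Ideal (MvPolynomial (Fin 3) ℂ)} {p : MvPolynomial (Fin 3) ℂ}
    (h : ∀ d ∈ p.support, monomial d (1 : ℂ) ∈ I) : p ∈ I := by
  rw [p.as_sum]
  refine Ideal.sum_mem _ fun d hd => ?_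
  have : monomial d (coeff d p) = C (coeff d p) * monomial d (1 : ℂ) := by
    rw [C_mul_monomial, mul_one]
  rw [this]
  exact I.mul_mem_left _ (h d hd)

/-- Coefficient extraction on the quotient by a monomial ideal, at a standard monomial. -/
noncomputable def qcoeff {I : Ideal (MvPolynomial (Fin 3) ℂ)} (hI : IsMonomialIdeal I)
    (s : Fin 3 →₀ ℕ) (hs : monomial s (1 : ℂ) ∉ I) :
    (MvPolynomial (Fin 3) ℂ ⧸ I) →ₗ[ℂ] ℂ :=
  (Submodule.liftQ (I.restrictScalars ℂ) (lcoeff ℂ s) (by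
    intro p hp
    rw [LinearMap.mem_ker, lcoeff_apply]
    by_contra h
    exact hs (hI p hp s (mem_support_iff.2 h)))) ∘ₗ
    (Submodule.Quotient.restrictScalarsEquiv ℂ I).symm.toLinearMap

theorem qcoeff_mk {I : Ideal (MvPolynomial (Fin 3) ℂ)} (hI : IsMonomialIdeal I)
    (s : Fin 3 →₀ ℕ) (hs : monomial s (1 : ℂ) ∉ I) (p : MvPolynomial (Fin 3) ℂ) :
    qcoeff hI s hs (Ideal.Quotient.mk I p) = coeff s p := rfl

theorem eq_zero_of_qcoeff {I : Ideal (MvPolynomial (Fin 3) ℂ)} (hI : IsMonomialIdeal I)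
    (q : MvPolynomial (Fin 3) ℂ ⧸ I) (h : ∀ s hs, qcoeff hI s hs q = 0) : q = 0 := by
  obtain ⟨p, rfl⟩ := Ideal.Quotient.mk_surjective q
  rw [Ideal.Quotient.eq_zero_iff_mem]
  refine mem_of_support fun d hd => ?_
  by_contra hn
  exact (mem_support_iff.1 hd) (h d hn)

open Classical in
/-- The matrix coefficient of a homomorphism `I → R/I` at a pair of monomials. -/
noncomputable def hcoeff {I : Ideal (MvPolynomial (Fin 3) ℂ)} (hI : IsMonomialIdeal I)
    (e s : Fin 3 →₀ ℕ) :
    (↥I →ₗ[MvPolynomial (Fin 3) ℂ] (MvPolynomial (Fin 3) ℂ ⧸ I)) →ₗ[ℂ] ℂ :=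
  if h : monomial e (1 : ℂ) ∈ I ∧ monomial s (1 : ℂ) ∉ I then
    { toFun := fun φ => qcoeff hI s h.2 (φ ⟨monomial e 1, h.1⟩)
      map_add' := by intros; simp
      map_smul' := by intros; simp }
  else 0

theorem hcoeff_apply {I : Ideal (MvPolynomial (Fin 3) ℂ)} (hI : IsMonomialIdeal I)
    (e s : Fin 3 →₀ ℕ) (he : monomial e (1 : ℂ) ∈ I) (hs : monomial s (1 : ℂ) ∉ I)
    (φ : ↥I →ₗ[MvPolynomial (Fin 3) ℂ] (MvPolynomial (Fin 3) ℂ ⧸ I)) :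
    hcoeff hI e s φ = qcoeff hI s hs (φ ⟨monomial e 1, he⟩) := by
  rw [hcoeff, dif_pos ⟨he, hs⟩]; rfl

theorem monomial_add (e d : Fin 3 →₀ ℕ) :
    monomial (e + d) (1 : ℂ) = monomial d 1 * monomial e 1 := by
  rw [monomial_mul, add_comm, mul_one]

theorem mem_add {I : Ideal (MvPolynomial (Fin 3) ℂ)} {e : Fin 3 →₀ ℕ}
    (he : monomial e (1 : ℂ) ∈ I) (d : Fin 3 →₀ ℕ) : monomial (e + d) (1 : ℂ) ∈ I := by
  rw [monomial_add]; exact I.mul_mem_left _ he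

theorem hom_apply_add {I : Ideal (MvPolynomial (Fin 3) ℂ)} (e d : Fin 3 →₀ ℕ)
    (he : monomial e (1 : ℂ) ∈ I)
    (φ : ↥I →ₗ[MvPolynomial (Fin 3) ℂ] (MvPolynomial (Fin 3) ℂ ⧸ I)) :
    φ ⟨monomial (e + d) 1, mem_add he d⟩ =
      (monomial d 1 : MvPolynomial (Fin 3) ℂ) • φ ⟨monomial e 1, he⟩ := by
  rw [← map_smul]
  congr 1
  ext1
  exact monomial_add e d

theorem hcoeff_add {I : Ideal (MvPolynomial (Fin 3) ℂ)} (hI : IsMonomialIdeal I)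
    (e s d : Fin 3 →₀ ℕ) (he : monomial e (1 : ℂ) ∈ I) (hs : monomial (s + d) (1 : ℂ) ∉ I)
    (φ : ↥I →ₗ[MvPolynomial (Fin 3) ℂ] (MvPolynomial (Fin 3) ℂ ⧸ I)) :
    hcoeff hI (e + d) (s + d) φ = hcoeff hI e s φ := by
  have hs' : monomial s (1 : ℂ) ∉ I := fun h => hs (mem_add h d)
  rw [hcoeff_apply hI _ _ (mem_add he d) hs, hcoeff_apply hI _ _ he hs', hom_apply_add e d he]
  obtain ⟨p, hp⟩ := Ideal.Quotient.mk_surjective (φ ⟨monomial e 1, he⟩)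
  rw [← hp, qcoeff_mk]
  change qcoeff hI _ hs (Ideal.Quotient.mk I (monomial d 1 * p)) = _
  rw [qcoeff_mk, add_comm s, coeff_monomial_mul, one_mul]

theorem hcoeff_eq_zero {I : Ideal (MvPolynomial (Fin 3) ℂ)} (hI : IsMonomialIdeal I)
    (e s d : Fin 3 →₀ ℕ) (he : monomial e (1 : ℂ) ∈ I)
    (hs : monomial s (1 : ℂ) ∉ I) (hd : ¬ d ≤ s)
    (φ : ↥I →ₗ[MvPolynomial (Fin 3) ℂ] (MvPolynomial (Fin 3) ℂ ⧸ I)) :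
    hcoeff hI (e + d) s φ = 0 := by
  rw [hcoeff_apply hI _ _ (mem_add he d) hs, hom_apply_add e d he]
  obtain ⟨p, hp⟩ := Ideal.Quotient.mk_surjective (φ ⟨monomial e 1, he⟩)
  rw [← hp]
  change qcoeff hI _ hs (Ideal.Quotient.mk I (monomial d 1 * p)) = _
  rw [qcoeff_mk, coeff_monomial_mul', if_neg hd]

theorem hom_eq_zero {I : Ideal (MvPolynomial (Fin 3) ℂ)} (hI : IsMonomialIdeal I)
    (φ : ↥I →ₗ[MvPolynomial (Fin 3) ℂ] (MvPolynomial (Fin 3) ℂ ⧸ I))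
    (h : ∀ e s, monomial e (1 : ℂ) ∈ I → monomial s (1 : ℂ) ∉ I → hcoeff hI e s φ = 0) :
    φ = 0 := by
  have key : ∀ e (he : monomial e (1 : ℂ) ∈ I), φ ⟨monomial e 1, he⟩ = 0 := fun e he =>
    eq_zero_of_qcoeff hI _ fun s hs => by rw [← hcoeff_apply hI e s he hs, h e s he hs]
  ext ⟨p, hp⟩
  have : (⟨p, hp⟩ : I) = ∑ d ∈ p.support.attach,
      (C (coeff d.1 p) : MvPolynomial (Fin 3) ℂ) • ⟨monomial d.1 1, hI p hp d.1 d.2⟩ := by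
    ext1
    rw [AddSubmonoidClass.coe_finsetSum]
    change p = ∑ d ∈ p.support.attach, C (coeff d.1 p) * monomial d.1 (1 : ℂ)
    rw [Finset.sum_attach p.support fun d => C (coeff d p) * monomial d (1 : ℂ)]
    conv_lhs => rw [p.as_sum]
    exact Finset.sum_congr rfl fun d _ => by rw [C_mul_monomial, mul_one]
  rw [this, map_sum]
  exact Finset.sum_eq_zero fun d _ => by rw [map_smul, key, smul_zero]

/-- Evaluation of homomorphisms `I → R/I` at a list of pairs of monomials. -/
noncomputable def evalMap {I : Ideal (MvPolynomial (Fin 3) ℂ)} (hI : IsMonomialIdeal I)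
    (L : List ((Fin 3 →₀ ℕ) × (Fin 3 →₀ ℕ))) :
    (↥I →ₗ[MvPolynomial (Fin 3) ℂ] (MvPolynomial (Fin 3) ℂ ⧸ I)) →ₗ[ℂ] (Fin L.length → ℂ) :=
  LinearMap.pi fun n => hcoeff hI (L.get n).1 (L.get n).2

theorem evalMap_injective {I : Ideal (MvPolynomial (Fin 3) ℂ)} (hI : IsMonomialIdeal I)
    (L : List ((Fin 3 →₀ ℕ) × (Fin 3 →₀ ℕ)))
    (h : ∀ φ, (∀ p ∈ L, hcoeff hI p.1 p.2 φ = 0) → φ = 0) :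
    Function.Injective (evalMap hI L) := by
  rw [← LinearMap.ker_eq_bot, LinearMap.ker_eq_bot']
  intro φ hφ
  refine h φ fun p hp => ?_
  obtain ⟨n, rfl⟩ := List.get_of_mem hp
  exact congrFun hφ n

theorem tangentDim_le {I : Ideal (MvPolynomial (Fin 3) ℂ)} (hI : IsMonomialIdeal I)
    (L : List ((Fin 3 →₀ ℕ) × (Fin 3 →₀ ℕ)))
    (h : ∀ φ, (∀ p ∈ L, hcoeff hI p.1 p.2 φ = 0) → φ = 0) :
    tangentDim I ≤ L.length := by
  have := LinearMap.finrank_le_finrank_of_injective (evalMap_injective hI L h)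
  rwa [Module.finrank_fin_fun] at this

theorem length_le_tangentDim {I : Ideal (MvPolynomial (Fin 3) ℂ)} (hI : IsMonomialIdeal I)
    (L : List ((Fin 3 →₀ ℕ) × (Fin 3 →₀ ℕ)))
    (h : ∀ φ, (∀ p ∈ L, hcoeff hI p.1 p.2 φ = 0) → φ = 0)
    (φ : Fin L.length → (↥I →ₗ[MvPolynomial (Fin 3) ℂ] (MvPolynomial (Fin 3) ℂ ⧸ I)))
    (hφ : ∀ m n, hcoeff hI (L.get m).1 (L.get m).2 (φ n) = if m = n then 1 else 0) :
    L.length ≤ tangentDim I := by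
  have hinj := evalMap_injective hI L h
  have hfin := Module.Finite.of_injective _ hinj
  have hsurj : Function.Surjective (evalMap hI L) := by
    intro x
    refine ⟨∑ n, x n • φ n, ?_⟩
    ext m
    rw [map_sum, Finset.sum_apply]
    simp only [map_smul, evalMap, LinearMap.pi_apply, hφ, smul_eq_mul, mul_ite,
      mul_one, mul_zero, Finset.sum_ite_eq, Finset.mem_univ, if_true]
  have := LinearMap.finrank_le_finrank_of_surjective (f := evalMap hI L) hsurj
  rwa [Module.finrank_fin_fun] at this

/-- The linear map sending `x^e` to `x^s` modulo `I` for all pairs `(e, s)` in `Q`. -/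
noncomputable def pairMap (I : Ideal (MvPolynomial (Fin 3) ℂ))
    (Q : Finset ((Fin 3 →₀ ℕ) × (Fin 3 →₀ ℕ))) :
    MvPolynomial (Fin 3) ℂ →ₗ[ℂ] (MvPolynomial (Fin 3) ℂ ⧸ I) :=
  ∑ p ∈ Q, (lcoeff ℂ p.1).smulRight (Ideal.Quotient.mk I (monomial p.2 1))

theorem pairMap_apply (I : Ideal (MvPolynomial (Fin 3) ℂ))
    (Q : Finset ((Fin 3 →₀ ℕ) × (Fin 3 →₀ ℕ))) (f : MvPolynomial (Fin 3) ℂ) :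
    pairMap I Q f = ∑ p ∈ Q, coeff p.1 f • Ideal.Quotient.mk I (monomial p.2 1) := by
  simp [pairMap, LinearMap.sum_apply]

/-- A set of pairs of monomials stable under simultaneous multiplication and division by variables,
whenever these are defined. -/
structure ClosedPairs (I : Ideal (MvPolynomial (Fin 3) ℂ))
    (Q : Finset ((Fin 3 →₀ ℕ) × (Fin 3 →₀ ℕ))) : Prop where
  up : ∀ e s v, (e, s) ∈ Q → monomial (s + Finsupp.single v 1) (1 : ℂ) ∉ I →
    (e + Finsupp.single v 1, s + Finsupp.single v 1) ∈ Q
  down : ∀ e s v, (e + Finsupp.single v 1, s) ∈ Q → monomial e (1 : ℂ) ∈ I →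
    ∃ s', s = s' + Finsupp.single v 1 ∧ (e, s') ∈ Q

theorem X_smul_mk (I : Ideal (MvPolynomial (Fin 3) ℂ)) (v : Fin 3) (c : ℂ) (s : Fin 3 →₀ ℕ) :
    (X v : MvPolynomial (Fin 3) ℂ) • (c • Ideal.Quotient.mk I (monomial s 1)) =
      c • Ideal.Quotient.mk I (monomial (s + Finsupp.single v 1) 1) := by
  rw [smul_comm, monomial_add]
  rfl

theorem pairMap_X_mul {I : Ideal (MvPolynomial (Fin 3) ℂ)} (hI : IsMonomialIdeal I)
    {Q : Finset ((Fin 3 →₀ ℕ) × (Fin 3 →₀ ℕ))} (hQ : ClosedPairs I Q)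
    (v : Fin 3) {f : MvPolynomial (Fin 3) ℂ} (hf : f ∈ I) :
    pairMap I Q (X v * f) = (X v : MvPolynomial (Fin 3) ℂ) • pairMap I Q f := by
  rw [pairMap_apply, pairMap_apply, Finset.smul_sum]
  simp only [X_smul_mk]
  symm
  refine Finset.sum_bij_ne_zero
    (fun p _ _ => (p.1 + Finsupp.single v 1, p.2 + Finsupp.single v 1)) ?_ ?_ ?_ ?_
  · rintro ⟨e, s⟩ hp hne
    refine hQ.up e s v hp fun hs => hne ?_
    rw [Ideal.Quotient.eq_zero_iff_mem.2 hs, smul_zero]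
  · rintro ⟨e, s⟩ _ _ ⟨e', s'⟩ _ _ h
    simpa using h
  · rintro ⟨e, s⟩ hp hne
    have h1 : coeff e (X v * f) ≠ 0 := fun h => hne (by rw [h, zero_smul])
    rw [coeff_X_mul', ne_eq, ite_eq_right_iff, Classical.not_imp] at h1
    have he : e = e - Finsupp.single v 1 + Finsupp.single v 1 :=
      (tsub_add_cancel_of_le (Finsupp.single_le_iff.2
        (Nat.one_le_iff_ne_zero.2 (Finsupp.mem_support_iff.1 h1.1)))).symm
    rw [he] at hp
    obtain ⟨s', rfl, h'⟩ := hQ.down _ _ _ hp (hI f hf _ (mem_support_iff.2 h1.2))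
    refine ⟨(_, s'), h', ?_, Prod.ext he.symm rfl⟩
    intro h
    refine hne ?_
    rw [← h]
    change coeff e (X v * f) • _ = coeff (e - Finsupp.single v 1) f • _
    rw [coeff_X_mul', if_pos h1.1]
  · rintro ⟨e, s⟩ hp hne
    rw [add_comm e, coeff_X_mul]

/-- The homomorphism `I → R/I` attached to a closed set of pairs. -/
noncomputable def pairHom {I : Ideal (MvPolynomial (Fin 3) ℂ)} (hI : IsMonomialIdeal I)
    {Q : Finset ((Fin 3 →₀ ℕ) × (Fin 3 →₀ ℕ))} (hQ : ClosedPairs I Q) :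
    ↥I →ₗ[MvPolynomial (Fin 3) ℂ] (MvPolynomial (Fin 3) ℂ ⧸ I) where
  toFun f := pairMap I Q f
  map_add' f g := map_add _ _ _
  map_smul' r f := by
    change pairMap I Q (r * f) = r • pairMap I Q f
    induction r using MvPolynomial.induction_on with
    | C a =>
      rw [← smul_eq_C_mul, map_smul, ← algebraMap_eq, algebraMap_smul]
    | add p q hp hq => rw [add_mul, map_add, hp, hq, add_smul]
    | mul_X p v hp =>
      rw [mul_comm p, mul_assoc, pairMap_X_mul hI hQ v (I.mul_mem_left p f.2), hp, mul_smul]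

theorem hcoeff_pairHom {I : Ideal (MvPolynomial (Fin 3) ℂ)} (hI : IsMonomialIdeal I)
    {Q : Finset ((Fin 3 →₀ ℕ) × (Fin 3 →₀ ℕ))} (hQ : ClosedPairs I Q) (e s : Fin 3 →₀ ℕ)
    (he : monomial e (1 : ℂ) ∈ I) (hs : monomial s (1 : ℂ) ∉ I) :
    hcoeff hI e s (pairHom hI hQ) = if (e, s) ∈ Q then 1 else 0 := by
  rw [hcoeff_apply hI e s he hs]
  change qcoeff hI s hs (pairMap I Q (monomial e 1)) = _
  rw [pairMap_apply, map_sum]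
  simp only [map_smul, qcoeff_mk, coeff_monomial, smul_eq_mul, mul_ite, mul_one, mul_zero]
  rw [Finset.sum_congr rfl (g := fun p => if (e, s) = p then (1 : ℂ) else 0), Finset.sum_ite_eq]
  rintro ⟨a, b⟩ _
  by_cases h1 : e = a
  · by_cases h2 : s = b
    · subst h1 h2; simp
    · rw [if_neg fun h : (e, s) = (a, b) => h2 (Prod.ext_iff.1 h).2]
      simp [Ne.symm h2]
  · rw [if_neg fun h : (e, s) = (a, b) => h1 (Prod.ext_iff.1 h).1]
    simp [h1]

theorem finrank_quotient {I : Ideal (MvPolynomial (Fin 3) ℂ)} (hI : IsMonomialIdeal I) :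
    Module.finrank ℂ (MvPolynomial (Fin 3) ℂ ⧸ I) =
      Nat.card {s : Fin 3 →₀ ℕ // monomial s (1 : ℂ) ∉ I} := by
  refine Module.finrank_eq_nat_card_basis (Module.Basis.mk (v := fun s :
    {s : Fin 3 →₀ ℕ // monomial s (1 : ℂ) ∉ I} => Ideal.Quotient.mk I (monomial s.1 1)) ?_ ?_)
  · rw [linearIndependent_iff']
    intro T g hg t ht
    have := congrArg (qcoeff hI t.1 t.2) hg
    rw [map_sum, map_zero] at this
    simp only [map_smul, qcoeff_mk, coeff_monomial, smul_eq_mul, mul_ite, mul_one, mul_zero] at this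
    rw [Finset.sum_eq_single_of_mem t ht, if_pos rfl] at this
    · exact this
    · intro b _ hb
      rw [if_neg fun h => hb (Subtype.ext h)]
  · rintro q -
    obtain ⟨p, rfl⟩ := Ideal.Quotient.mk_surjective q
    rw [p.as_sum, map_sum]
    refine Submodule.sum_mem _ fun d _ => ?_
    by_cases hd : monomial d (1 : ℂ) ∈ I
    · have : monomial d (coeff d p) ∈ I := by
        have : monomial d (coeff d p) = C (coeff d p) * monomial d (1 : ℂ) := by
          rw [C_mul_monomial, mul_one]
        rw [this]
        exact I.mul_mem_left _ hd
      rw [Ideal.Quotient.eq_zero_iff_mem.2 this]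
      exact Submodule.zero_mem _
    · have : Ideal.Quotient.mk I (monomial d (coeff d p)) =
          coeff d p • Ideal.Quotient.mk I (monomial d 1) := by
        have : monomial d (coeff d p) = coeff d p • monomial d (1 : ℂ) := by
          rw [smul_monomial, smul_eq_mul, mul_one]
        rw [this]
        rfl
      rw [this]
      exact Submodule.smul_mem _ _ (Submodule.subset_span ⟨⟨d, hd⟩, rfl⟩)

section

/-- The length of the `i`-th row in the `k`-th slice of a stack of slices. -/
def len (sl : List (List ℕ)) (k i : ℕ) : ℕ := (sl.getD k []).getD i 0

/-- The exponents in the `k`-th slice. -/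
def cell (sl : List (List ℕ)) (i j k : ℕ) : Bool := Nat.ble (j + 1) (len sl k i)

/-- The height of the column over `(i, j)`. -/
def height : List (List ℕ) → ℕ → ℕ → ℕ
  | [], _, _ => 0
  | r :: sl, i, j => bif Nat.ble (j + 1) (r.getD i 0) then height sl i j + 1 else 0

/-- A pair of exponents `(e, s)`, standing for the matrix coefficient of `x^s` in the image
of `x^e`. -/
abbrev Pair := (ℕ × ℕ × ℕ) × (ℕ × ℕ × ℕ)

/-- The cells of a slice. -/
def cells (r : List ℕ) : List (ℕ × ℕ) :=
  (List.range r.length).flatMap fun i => (List.range (r.getD i 0)).map fun j => (i, j)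

/-- Normal forms for pairs `(e, s)` with `e₃ ≤ s₃`. -/
def plusForms (sl : List (List ℕ)) : List Pair :=
  (List.range sl.length).reverse.flatMap fun k => (cells (sl.getD k [])).reverse.flatMap fun c =>
    (List.range ((sl.getD k []).length + 1)).reverse.map fun a =>
      ((a, len sl k a, k), (c.1, c.2, height sl c.1 c.2 - 1))

/-- Normal forms for pairs `(e, s)` with `s₃ < e₃`. -/
def minusForms (sl : List (List ℕ)) : List Pair :=
  (List.range sl.length).flatMap fun k => (cells (sl.getD k [])).flatMap fun c =>
    (List.range (sl.getD k []).length).map fun i =>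
      ((c.1, c.2, height sl c.1 c.2), (i, len sl k i - 1, k))

/-- Matrix coefficients of homomorphisms `I → R/I`, where the standard monomials of `I` are the
cells of `sl`. -/
structure TangentFun (sl : List (List ℕ)) (c : ℕ → ℕ → ℕ → ℕ → ℕ → ℕ → ℂ) : Prop where
  off : ∀ a b k i j t, len sl t i ≤ j → c a b k i j t = 0
  shift : ∀ a b k i j t u v w, len sl k a ≤ b → j + v < len sl (t + w) (i + u) →
    c (a + u) (b + v) (k + w) (i + u) (j + v) (t + w) = c a b k i j t
  ground : ∀ a b k i j t u v w, len sl k a ≤ b → i < u ∨ j < v ∨ t < w →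
    c (a + u) (b + v) (k + w) i j t = 0

/-- The cells form an order ideal. -/
def Antitone₂ (sl : List (List ℕ)) : Prop :=
  ∀ k k' i i', k ≤ k' → i ≤ i' → len sl k' i' ≤ len sl k i

theorem lt_height {sl : List (List ℕ)} {i j k : ℕ} (h : k < height sl i j) : j < len sl k i := by
  induction sl generalizing k with
  | nil => simp [height] at h
  | cons r sl ih =>
    rw [height] at h
    cases hb : Nat.ble (j + 1) (r.getD i 0) with
    | false => simp [hb, -List.getD_eq_getElem?_getD] at h
    | true =>
      rw [hb] at h
      cases k with
      | zero => simpa [len] using Nat.le_of_ble_eq_true hb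
      | succ k => exact ih (k := k) (by simpa using h)

theorem len_height (sl : List (List ℕ)) (i j : ℕ) : len sl (height sl i j) i ≤ j := by
  induction sl with
  | nil => simp [len]
  | cons r sl ih =>
    rw [height]
    cases hb : Nat.ble (j + 1) (r.getD i 0) with
    | false =>
      have : ¬ j + 1 ≤ r.getD i 0 := fun h => by rw [Nat.ble_eq_true_of_le h] at hb; cases hb
      simp [len] at this ⊢
      omega
    | true => exact ih

theorem Antitone₂.lt_height_iff {sl : List (List ℕ)} (h : Antitone₂ sl) {i j k : ℕ} :
    k < height sl i j ↔ j < len sl k i := by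
  refine ⟨lt_height, fun h' => ?_⟩
  by_contra hk
  have := h _ _ i i (not_lt.1 hk) le_rfl
  have := len_height sl i j
  omega

theorem mem_cells {r : List ℕ} {i j : ℕ} : (i, j) ∈ cells r ↔ j < r.getD i 0 := by
  simp only [cells, List.mem_flatMap, List.mem_map, List.mem_range, Prod.mk.injEq]
  constructor
  · rintro ⟨_, _, _, h, rfl, rfl⟩; exact h
  · intro h
    refine ⟨i, ?_, j, h, rfl, rfl⟩
    by_contra hi
    rw [List.getD_eq_default _ _ (not_lt.1 hi)] at h
    omega

theorem lt_length_of_lt_len {sl : List (List ℕ)} {i j k : ℕ} (h : j < len sl k i) :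
    k < sl.length := by
  by_contra hk
  rw [len, List.getD_eq_default _ _ (not_lt.1 hk)] at h
  simp at h

theorem mem_plusForms {sl : List (List ℕ)} {a k i j : ℕ} (h : j < len sl k i)
    (ha : a ≤ (sl.getD k []).length) :
    ((a, len sl k a, k), (i, j, height sl i j - 1)) ∈ plusForms sl :=
  List.mem_flatMap.2 ⟨k, List.mem_reverse.2 (List.mem_range.2 (lt_length_of_lt_len h)),
    List.mem_flatMap.2 ⟨(i, j), List.mem_reverse.2 (mem_cells.2 h), List.mem_map.2
      ⟨a, List.mem_reverse.2 (List.mem_range.2 (Nat.lt_succ_of_le ha)), rfl⟩⟩⟩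

theorem mem_minusForms {sl : List (List ℕ)} {a b k i : ℕ} (h : b < len sl k a)
    (hi : i < (sl.getD k []).length) :
    ((a, b, height sl a b), (i, len sl k i - 1, k)) ∈ minusForms sl :=
  List.mem_flatMap.2 ⟨k, List.mem_range.2 (lt_length_of_lt_len h), List.mem_flatMap.2
    ⟨(a, b), mem_cells.2 h, List.mem_map.2 ⟨i, List.mem_range.2 hi, rfl⟩⟩⟩

theorem lt_length_row {sl : List (List ℕ)} {i j k : ℕ} (h : j < len sl k i) :
    i < (sl.getD k []).length := by
  by_contra hk
  rw [len, List.getD_eq_default _ _ (not_lt.1 hk)] at h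
  omega

variable {sl : List (List ℕ)} {c : ℕ → ℕ → ℕ → ℕ → ℕ → ℕ → ℂ}

theorem TangentFun.eq_zero_plus (hc : TangentFun sl c) (hsl : Antitone₂ sl)
    (h : ∀ p ∈ plusForms sl, c p.1.1 p.1.2.1 p.1.2.2 p.2.1 p.2.2.1 p.2.2.2 = 0)
    (n a b k i j t : ℕ) (hn : a + b = n) (he : len sl k a ≤ b) (hs : j < len sl t i)
    (hkt : k ≤ t) : c a b k i j t = 0 := by
  induction n using Nat.strong_induction_on generalizing a b k i j t with
  | _ n ih =>
    obtain ⟨w, hw⟩ : ∃ w, height sl i j = t + w + 1 :=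
      Nat.exists_eq_add_of_lt (hsl.lt_height_iff.2 hs)
    have hs' : j < len sl (t + w) i := lt_height (by omega)
    have he' : len sl (k + w) a ≤ b := (hsl _ _ a a (Nat.le_add_right k w) le_rfl).trans he
    rw [← hc.shift a b k i j t 0 0 w he (by simpa using hs')]
    simp only [Nat.add_zero]
    by_cases ha : ∃ a', a = a' + 1 ∧ len sl (k + w) a' ≤ b
    · obtain ⟨a', rfl, ha⟩ := ha
      cases i with
      | zero => simpa using hc.ground a' b (k + w) 0 j (t + w) 1 0 0 ha (by simp)
      | succ i =>
        have h1 := hc.shift a' b (k + w) i j (t + w) 1 0 0 ha (by simpa using hs')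
        simp only [Nat.add_zero] at h1
        rw [h1]
        exact ih (a' + b) (by omega) a' b _ i j _ rfl ha
          (hs'.trans_le (hsl _ _ _ _ le_rfl (Nat.le_succ i))) (by omega)
    by_cases hb : ∃ b', b = b' + 1 ∧ len sl (k + w) a ≤ b'
    · obtain ⟨b', rfl, hb⟩ := hb
      cases j with
      | zero => simpa using hc.ground a b' (k + w) i 0 (t + w) 0 1 0 hb (by simp)
      | succ j =>
        have h1 := hc.shift a b' (k + w) i j (t + w) 0 1 0 hb (by simpa using hs')
        simp only [Nat.add_zero] at h1
        rw [h1]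
        exact ih (a + b') (by omega) a b' _ i j _ rfl hb (by omega) (by omega)
    have hb' : b = len sl (k + w) a := by
      cases b with
      | zero => omega
      | succ b =>
        by_contra hne
        exact hb ⟨b, rfl, by omega⟩
    have ha' : a ≤ (sl.getD (k + w) []).length := by
      cases a with
      | zero => omega
      | succ a =>
        by_contra hlt
        refine ha ⟨a, rfl, ?_⟩
        rw [len, List.getD_eq_default _ _ (by omega)]
        omega
    have := h _ (mem_plusForms (k := k + w)
      (hs'.trans_le (hsl (k + w) (t + w) i i (by omega) le_rfl)) ha')
    rw [hw, ← hb'] at this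
    exact this

theorem TangentFun.eq_zero_minus (hc : TangentFun sl c) (hsl : Antitone₂ sl)
    (h : ∀ p ∈ minusForms sl, c p.1.1 p.1.2.1 p.1.2.2 p.2.1 p.2.2.1 p.2.2.2 = 0)
    (a b k i j t : ℕ) (he : len sl k a ≤ b) (hs : j < len sl t i)
    (hkt : t < k) : c a b k i j t = 0 := by
  induction k generalizing b j t with
  | zero => omega
  | succ k ih =>
    obtain ⟨v, hv⟩ : ∃ v, len sl t i = j + v + 1 := Nat.exists_eq_add_of_lt hs
    rw [← hc.shift a b (k + 1) i j t 0 v 0 he (by simp; omega)]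
    simp only [Nat.add_zero]
    by_cases hk : len sl k a ≤ b + v
    · cases t with
      | zero => simpa using hc.ground a (b + v) k i (j + v) 0 0 0 1 hk (by simp)
      | succ t =>
        have h1 := hc.shift a (b + v) k i (j + v) t 0 0 1 hk (by simp; omega)
        simp only [Nat.add_zero] at h1
        rw [h1]
        exact ih (b + v) (j + v) t hk
          ((by omega : j + v < len sl (t + 1) i).trans_le (hsl _ _ _ _ (Nat.le_succ t) le_rfl))
          (by omega)
    · have hh : height sl a (b + v) = k + 1 := by
        have h1 := hsl.lt_height_iff.2 (not_le.1 hk)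
        have h2 : ¬ k + 1 < height sl a (b + v) := fun h' => by
          have := lt_height h'
          omega
        omega
      have := h _ (mem_minusForms (k := t) (i := i)
        ((not_le.1 hk).trans_le (hsl _ _ _ _ (by omega) le_rfl)) (lt_length_row hs))
      simp only [hh, hv, Nat.add_sub_cancel] at this
      exact this

theorem length_cells (r : List ℕ) : (cells r).length = r.sum := by
  rw [cells, List.length_flatMap]
  congr 1
  refine List.ext_getElem (by simp) fun i h1 h2 => ?_
  simp [List.getElem?_eq_getElem h2]

theorem map_range_getD {α β : Type*} (l : List α) (d : α) (f : α → β) :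
    ((List.range l.length).map fun k => f (l.getD k d)) = l.map f := by
  refine List.ext_getElem (by simp) fun i h1 h2 => ?_
  rw [List.length_map] at h2
  simp [List.getElem?_eq_getElem h2]

theorem length_plusForms (sl : List (List ℕ)) :
    (plusForms sl).length = (sl.map fun r => r.sum * (r.length + 1)).sum := by
  simp [plusForms, List.length_flatMap, length_cells, -List.getD_eq_getElem?_getD]
  rw [map_range_getD sl [] fun r => r.sum * (r.length + 1)]

theorem length_minusForms (sl : List (List ℕ)) :
    (minusForms sl).length = (sl.map fun r => r.sum * r.length).sum := by
  simp [minusForms, List.length_flatMap, length_cells, -List.getD_eq_getElem?_getD]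
  rw [map_range_getD sl [] fun r => r.sum * r.length]

end

section

/-- Vanishing of a matrix coefficient along a path of divisions by `z`, multiplications by `x`
and divisions by `y`. -/
def killX (sl : List (List ℕ)) (p : Pair) (r q : ℕ) : Bool :=
  Nat.ble r p.1.2.2 && (Nat.ble r p.2.2.2 &&
  (cell sl (p.2.1 + q) p.2.2.1 (p.2.2.2 - r) &&
  (!cell sl p.1.1 p.1.2.1 (p.1.2.2 - r) &&
  !cell sl (p.1.1 + q) (p.1.2.1 - (p.2.2.1 + 1)) (p.1.2.2 - r))))

/-- Vanishing of a matrix coefficient along a path of divisions by `z`, multiplications by `y`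
and divisions by `x`. -/
def killY (sl : List (List ℕ)) (p : Pair) (r q : ℕ) : Bool :=
  Nat.ble r p.1.2.2 && (Nat.ble r p.2.2.2 &&
  (cell sl p.2.1 (p.2.2.1 + q) (p.2.2.2 - r) &&
  (!cell sl p.1.1 p.1.2.1 (p.1.2.2 - r) &&
  !cell sl (p.1.1 - (p.2.1 + 1)) (p.1.2.1 + q) (p.1.2.2 - r))))

/-- Vanishing of a matrix coefficient along a path of multiplications by `z`
and divisions by `y`. -/
def killZ (sl : List (List ℕ)) (p : Pair) : Bool :=
  Nat.ble 1 p.2.2.1 && (Nat.ble (p.2.2.1 + 1) p.1.2.1 &&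
  (cell sl p.2.1 p.2.2.1 (p.2.2.2 + 1) &&
  (!cell sl p.1.1 (p.1.2.1 - 1) (p.1.2.2 + 1) &&
  (cell sl p.2.1 (p.2.2.1 - 1) (p.2.2.2 + 3) &&
  !cell sl p.1.1 (p.1.2.1 - (p.2.2.1 + 1)) (p.1.2.2 + 3)))))

/-- The matrix coefficient at a pair vanishes for one of the above reasons. -/
def killed (sl : List (List ℕ)) (p : Pair) : Bool :=
  (Nat.ble (p.2.2.1 + 1) p.1.2.1 &&
    [1, 2, 3].any fun r => [1, 2].any fun q => killX sl p r q) ||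
  ((Nat.ble (p.2.1 + 1) p.1.1 &&
    [1, 2, 3].any fun r => [1, 2].any fun q => killY sl p r q) ||
  killZ sl p)

/-- Remove at most the first `n` killed pairs from a list. -/
def dropKilled (sl : List (List ℕ)) : ℕ → List Pair → List Pair
  | 0, l => l
  | _ + 1, [] => []
  | n + 1, p :: l => bif killed sl p then dropKilled sl n l else p :: dropKilled sl (n + 1) l

/-- At least `n` pairs of a list are killed. -/
def hasKilled (sl : List (List ℕ)) : ℕ → List Pair → Bool
  | 0, _ => true
  | _ + 1, [] => false
  | n + 1, p :: l => bif killed sl p then hasKilled sl n l else hasKilled sl (n + 1) l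

theorem length_dropKilled (sl : List (List ℕ)) (n : ℕ) (l : List Pair)
    (h : hasKilled sl n l = true) : (dropKilled sl n l).length + n = l.length := by
  induction l generalizing n with
  | nil =>
    cases n with
    | zero => rfl
    | succ n => simp [hasKilled] at h
  | cons p l ih =>
    cases n with
    | zero => rfl
    | succ n =>
      rw [hasKilled] at h
      rw [dropKilled]
      cases hp : killed sl p with
      | true =>
        rw [hp] at h
        have := ih n h
        simp only [cond_true, List.length_cons]
        omega
      | false =>
        rw [hp] at h
        have := ih (n + 1) h
        simp only [cond_false, List.length_cons]
        omega

/-- The normal forms; their matrix coefficients determine a homomorphism `I → R/I`. -/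
def forms (sl : List (List ℕ)) : List Pair := plusForms sl ++ minusForms sl

/-- The slices that can lie directly below a given slice. -/
def succs : List ℕ → List (List ℕ)
  | [] => [[], [1]]
  | b :: bs => (succs bs).flatMap fun l =>
      bif Nat.ble (l.headD 0 + 1) b then [b :: l, (b + 1) :: l] else [(b + 1) :: l]

/-- Exhaustive check that every stack of `35` cells ending in `sl` whose first slice has `m` rows
has at most `thr` normal forms that are not killed. Here `tot` is the number of cells of `sl` and
`acc` the sum over its slices of the number of cells times the number of rows. -/
def search (m thr : ℕ) : ℕ → List (List ℕ) → ℕ → ℕ → Bool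
  | 0, _, _, _ => false
  | f + 1, sl, tot, acc =>
    Nat.ble (35 + 2 * (acc + m * (35 - tot))) thr || (Nat.ble 36 tot ||
    (Nat.ble (m + 1) (sl.headD []).length ||
    bif Nat.beq tot 35 then
      !Nat.beq m (sl.headD []).length ||
        hasKilled sl (35 + 2 * acc - thr) (forms sl)
    else (succs (sl.headD [])).all fun r => r.isEmpty ||
      search m thr f (r :: sl) (tot + r.sum) (acc + r.sum * r.length)))

variable {sl : List (List ℕ)} {c : ℕ → ℕ → ℕ → ℕ → ℕ → ℕ → ℂ}

theorem cell_eq_true {i j k : ℕ} : cell sl i j k = true ↔ j < len sl k i := by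
  rw [cell, Nat.ble_eq]; rfl

theorem cell_eq_false {i j k : ℕ} : cell sl i j k = false ↔ len sl k i ≤ j := by
  rw [← Bool.not_eq_true, cell_eq_true, not_lt]

theorem TangentFun.eq_zero_of_killX (hc : TangentFun sl c) {a b k i j t r q : ℕ}
    (hj : j + 1 ≤ b) (h : killX sl ((a, b, k), (i, j, t)) r q = true) : c a b k i j t = 0 := by
  simp only [killX, Bool.and_eq_true, Nat.ble_eq, cell_eq_true, Bool.not_eq_true',
    cell_eq_false] at h
  obtain ⟨hk, ht, h1, h2, h3⟩ := h
  obtain ⟨k, rfl⟩ := Nat.exists_eq_add_of_le' hk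
  obtain ⟨t, rfl⟩ := Nat.exists_eq_add_of_le' ht
  obtain ⟨b, rfl⟩ := Nat.exists_eq_add_of_le' hj
  simp only [Nat.add_sub_cancel] at h1 h2 h3
  by_cases hs : j < len sl (t + r) i
  · have e1 := hc.shift a (b + (j + 1)) k i j t 0 0 r h2 hs
    have e2 := hc.shift a (b + (j + 1)) k i j t q 0 0 h2 h1
    have e3 := hc.ground (a + q) b k (i + q) j t 0 (j + 1) 0 h3 (by omega)
    simp only [Nat.add_zero] at e1 e2 e3
    rw [e1, ← e2, e3]
  · exact hc.off _ _ _ _ _ _ (not_lt.1 hs)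

theorem TangentFun.eq_zero_of_killY (hc : TangentFun sl c) {a b k i j t r q : ℕ}
    (hj : i + 1 ≤ a) (h : killY sl ((a, b, k), (i, j, t)) r q = true) : c a b k i j t = 0 := by
  simp only [killY, Bool.and_eq_true, Nat.ble_eq, cell_eq_true, Bool.not_eq_true',
    cell_eq_false] at h
  obtain ⟨hk, ht, h1, h2, h3⟩ := h
  obtain ⟨k, rfl⟩ := Nat.exists_eq_add_of_le' hk
  obtain ⟨t, rfl⟩ := Nat.exists_eq_add_of_le' ht
  obtain ⟨a, rfl⟩ := Nat.exists_eq_add_of_le' hj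
  simp only [Nat.add_sub_cancel] at h1 h2 h3
  by_cases hs : j < len sl (t + r) i
  · have e1 := hc.shift (a + (i + 1)) b k i j t 0 0 r h2 hs
    have e2 := hc.shift (a + (i + 1)) b k i j t 0 q 0 h2 h1
    have e3 := hc.ground a (b + q) k i (j + q) t (i + 1) 0 0 h3 (by omega)
    simp only [Nat.add_zero] at e1 e2 e3
    rw [e1, ← e2, e3]
  · exact hc.off _ _ _ _ _ _ (not_lt.1 hs)

theorem TangentFun.eq_zero_of_killZ (hc : TangentFun sl c) {a b k i j t : ℕ}
    (he : len sl k a ≤ b)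
    (h : killZ sl ((a, b, k), (i, j, t)) = true) : c a b k i j t = 0 := by
  simp only [killZ, Bool.and_eq_true, Nat.ble_eq, cell_eq_true, Bool.not_eq_true',
    cell_eq_false] at h
  obtain ⟨hj, hb, h1, h2, h3, h4⟩ := h
  obtain ⟨j, rfl⟩ := Nat.exists_eq_add_of_le' hj
  obtain ⟨b, rfl⟩ := Nat.exists_eq_add_of_le' hb
  simp only [Nat.add_sub_cancel] at h1 h2 h3 h4
  have h2' : len sl (k + 1) a ≤ b + (j + 1) := h2
  have e1 := hc.shift a (b + (j + 1 + 1)) k i (j + 1) t 0 0 1 he h1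
  have e2 := hc.shift a (b + (j + 1)) (k + 1) i j (t + 1) 0 1 0 h2' h1
  have e3 := hc.shift a (b + (j + 1)) (k + 1) i j (t + 1) 0 0 2 h2' h3
  have e4 := hc.ground a b (k + 3) i j (t + 3) 0 (j + 1) 0 h4 (by omega)
  simp only [Nat.add_zero] at e1 e2 e3 e4
  rw [← e1]
  exact e2.trans (e3.symm.trans e4)

theorem TangentFun.eq_zero_of_killed (hc : TangentFun sl c) {p : Pair}
    (he : len sl p.1.2.2 p.1.1 ≤ p.1.2.1) (h : killed sl p = true) :
    c p.1.1 p.1.2.1 p.1.2.2 p.2.1 p.2.2.1 p.2.2.2 = 0 := by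
  obtain ⟨⟨a, b, k⟩, ⟨i, j, t⟩⟩ := p
  simp only [killed, Bool.or_eq_true, Bool.and_eq_true, List.any_eq_true, Nat.ble_eq] at h
  obtain ⟨hj, r, -, q, -, h⟩ | ⟨hj, r, -, q, -, h⟩ | h := h
  · exact hc.eq_zero_of_killX hj h
  · exact hc.eq_zero_of_killY hj h
  · exact hc.eq_zero_of_killZ he h

theorem TangentFun.eq_zero_of_dropKilled (hc : TangentFun sl c) (n : ℕ) (l : List Pair)
    (hl : ∀ p ∈ l, len sl p.1.2.2 p.1.1 ≤ p.1.2.1)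
    (h : ∀ p ∈ dropKilled sl n l, c p.1.1 p.1.2.1 p.1.2.2 p.2.1 p.2.2.1 p.2.2.2 = 0) :
    ∀ p ∈ l, c p.1.1 p.1.2.1 p.1.2.2 p.2.1 p.2.2.1 p.2.2.2 = 0 := by
  induction l generalizing n with
  | nil => simp
  | cons p l ih =>
    cases n with
    | zero => exact h
    | succ n =>
      rw [List.forall_mem_cons] at hl
      rw [dropKilled] at h
      cases hp : killed sl p with
      | true =>
        rw [hp] at h
        exact List.forall_mem_cons.2 ⟨hc.eq_zero_of_killed hl.1 hp, ih n hl.2 h⟩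
      | false =>
        rw [hp] at h
        have h' := List.forall_mem_cons.1 h
        exact List.forall_mem_cons.2 ⟨h'.1, ih (n + 1) hl.2 h'.2⟩

theorem len_le_of_mem_forms {p : Pair} (h : p ∈ forms sl) :
    len sl p.1.2.2 p.1.1 ≤ p.1.2.1 := by
  rcases List.mem_append.1 h with h | h
  · simp only [plusForms, List.mem_flatMap, List.mem_map] at h
    obtain ⟨k, -, c, -, a, -, rfl⟩ := h
    exact le_rfl
  · simp only [minusForms, List.mem_flatMap, List.mem_map] at h
    obtain ⟨k, -, c, -, a, -, rfl⟩ := h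
    exact len_height _ _ _

theorem length_forms (sl : List (List ℕ)) :
    (forms sl).length = (sl.map List.sum).sum + 2 * (sl.map fun r => r.sum * r.length).sum := by
  rw [forms, List.length_append, length_plusForms, length_minusForms]
  induction sl with
  | nil => rfl
  | cons r sl ih =>
    simp only [List.map_cons, List.sum_cons]
    linarith [mul_add r.sum r.length 1]

/-- The exponent vector `(a, b, k)`. -/
noncomputable def ex (a b k : ℕ) : Fin 3 →₀ ℕ := Finsupp.equivFunOnFinite.symm ![a, b, k]

@[simp] theorem ex_zero (a b k : ℕ) : ex a b k 0 = a := rfl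
@[simp] theorem ex_one (a b k : ℕ) : ex a b k 1 = b := rfl
@[simp] theorem ex_two (a b k : ℕ) : ex a b k 2 = k := rfl

theorem ex_apply (d : Fin 3 →₀ ℕ) : ex (d 0) (d 1) (d 2) = d := by
  ext i; fin_cases i <;> rfl

theorem ex_add (a b k u v w : ℕ) : ex (a + u) (b + v) (k + w) = ex a b k + ex u v w := by
  ext i; fin_cases i <;> rfl

theorem le_iff_ex {d e : Fin 3 →₀ ℕ} : d ≤ e ↔ d 0 ≤ e 0 ∧ d 1 ≤ e 1 ∧ d 2 ≤ e 2 := by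
  rw [Finsupp.le_def]
  exact ⟨fun h => ⟨h 0, h 1, h 2⟩, fun h i => by fin_cases i; exacts [h.1, h.2.1, h.2.2]⟩

/-- The standard monomials of `I` are the cells of `sl`. -/
def HasShape (I : Ideal (MvPolynomial (Fin 3) ℂ)) (sl : List (List ℕ)) : Prop :=
  ∀ a b k, monomial (ex a b k) (1 : ℂ) ∈ I ↔ len sl k a ≤ b

variable {I : Ideal (MvPolynomial (Fin 3) ℂ)}

theorem HasShape.notMem (h : HasShape I sl) (a b k : ℕ) :
    monomial (ex a b k) (1 : ℂ) ∉ I ↔ b < len sl k a := by rw [h, not_le]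

theorem HasShape.antitone (h : HasShape I sl) : Antitone₂ sl := by
  intro k k' i i' hk hi
  obtain ⟨w, rfl⟩ := Nat.exists_eq_add_of_le hk
  obtain ⟨u, rfl⟩ := Nat.exists_eq_add_of_le hi
  have := mem_add ((h i (len sl k i) k).2 le_rfl) (ex u 0 w)
  rwa [← ex_add, h] at this

theorem HasShape.tangentFun (h : HasShape I sl) (hI : IsMonomialIdeal I)
    (φ : ↥I →ₗ[MvPolynomial (Fin 3) ℂ] (MvPolynomial (Fin 3) ℂ ⧸ I)) :
    TangentFun sl fun a b k i j t => hcoeff hI (ex a b k) (ex i j t) φ where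
  off a b k i j t hs := by
    rw [hcoeff, dif_neg fun h' => h'.2 ((h _ _ _).2 hs)]
    rfl
  shift a b k i j t u v w he hs := by
    rw [ex_add, ex_add]
    exact hcoeff_add hI _ _ _ ((h _ _ _).2 he) (by rw [← ex_add]; exact (h.notMem _ _ _).2 hs) φ
  ground a b k i j t u v w he hs := by
    by_cases hs' : monomial (ex i j t) (1 : ℂ) ∈ I
    · rw [hcoeff, dif_neg fun h' => h'.2 hs']
      rfl
    rw [ex_add]
    refine hcoeff_eq_zero hI _ _ _ ((h _ _ _).2 he) hs' ?_ φ
    rw [le_iff_ex]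
    simp only [ex_zero, ex_one, ex_two]
    omega

/-- A pair of exponent triples as a pair of exponent vectors. -/
noncomputable def exPair (p : Pair) : (Fin 3 →₀ ℕ) × (Fin 3 →₀ ℕ) :=
  (ex p.1.1 p.1.2.1 p.1.2.2, ex p.2.1 p.2.2.1 p.2.2.2)

theorem HasShape.hom_eq_zero (h : HasShape I sl) (hI : IsMonomialIdeal I) (n : ℕ)
    (φ : ↥I →ₗ[MvPolynomial (Fin 3) ℂ] (MvPolynomial (Fin 3) ℂ ⧸ I))
    (hφ : ∀ p ∈ (dropKilled sl n (forms sl)).map exPair, hcoeff hI p.1 p.2 φ = 0) : φ = 0 := by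
  have hc := h.tangentFun hI φ
  have h0 := hc.eq_zero_of_dropKilled n (forms sl) (fun p => len_le_of_mem_forms)
    fun p hp => hφ (exPair p) (List.mem_map_of_mem hp)
  refine BorelTangent.hom_eq_zero hI φ fun e s he hs => ?_
  rw [← ex_apply e] at he ⊢
  rw [← ex_apply s] at hs ⊢
  rw [h] at he
  rw [h.notMem] at hs
  rcases le_or_gt (e 2) (s 2) with hes | hes
  · exact hc.eq_zero_plus h.antitone
      (fun p hp => h0 p (List.mem_append_left _ hp)) _ _ _ _ _ _ _ rfl he hs hes
  · exact hc.eq_zero_minus h.antitone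
      (fun p hp => h0 p (List.mem_append_right _ hp)) _ _ _ _ _ _ he hs hes

theorem HasShape.tangentDim_le (h : HasShape I sl) (hI : IsMonomialIdeal I) (n : ℕ) :
    tangentDim I ≤ (dropKilled sl n (forms sl)).length := by
  have := BorelTangent.tangentDim_le hI _ (h.hom_eq_zero hI n)
  rwa [List.length_map] at this

end

section

/-- Boolean equality of pairs. -/
def eqPair (p q : Pair) : Bool :=
  Nat.beq p.1.1 q.1.1 && (Nat.beq p.1.2.1 q.1.2.1 && (Nat.beq p.1.2.2 q.1.2.2 &&
  (Nat.beq p.2.1 q.2.1 && (Nat.beq p.2.2.1 q.2.2.1 && Nat.beq p.2.2.2 q.2.2.2))))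

/-- Boolean membership of a pair in a list. -/
def memPair (p : Pair) (l : List Pair) : Bool := l.any (eqPair p)

/-- The products of a pair by a variable. -/
def ups (sl : List (List ℕ)) : Pair → List Pair
  | ((a, b, k), (i, j, t)) =>
    (bif cell sl (i + 1) j t then [((a + 1, b, k), (i + 1, j, t))] else []) ++
    ((bif cell sl i (j + 1) t then [((a, b + 1, k), (i, j + 1, t))] else []) ++
    (bif cell sl i j (t + 1) then [((a, b, k + 1), (i, j, t + 1))] else []))

/-- The quotients of a pair by a variable; `none` when the second entry is not divisible. -/
def downs (sl : List (List ℕ)) : Pair → List (Option Pair)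
  | ((a, b, k), (i, j, t)) =>
    (match a with
      | 0 => []
      | a + 1 => bif cell sl a b k then [] else
        match i with | 0 => [none] | i + 1 => [some ((a, b, k), (i, j, t))]) ++
    ((match b with
      | 0 => []
      | b + 1 => bif cell sl a b k then [] else
        match j with | 0 => [none] | j + 1 => [some ((a, b, k), (i, j, t))]) ++
    (match k with
      | 0 => []
      | k + 1 => bif cell sl a b k then [] else
        match t with | 0 => [none] | t + 1 => [some ((a, b, k), (i, j, t))]))

/-- The smallest set of pairs containing `acc` and `todo` and closed under `ups` and `downs`,
when the fuel suffices. -/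
def closure (sl : List (List ℕ)) : ℕ → List Pair → List Pair → List Pair
  | 0, _, acc => acc
  | _ + 1, [], acc => acc
  | f + 1, p :: todo, acc =>
    bif memPair p acc then closure sl f todo acc
    else closure sl f (ups sl p ++ ((downs sl p).filterMap id ++ todo)) (p :: acc)

/-- Stability of a list of pairs under `ups` and `downs`. -/
def isClosed (sl : List (List ℕ)) (P : List Pair) : Bool :=
  P.all fun p => (ups sl p).all (memPair · P) &&
    (downs sl p).all fun q => match q with | none => false | some q => memPair q P

/-- The list has no repetitions. -/
def nodupPair : List Pair → Bool
  | [] => true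
  | p :: l => !memPair p l && nodupPair l

/-- The closure of `p` is closed and meets `L` in `p` only. -/
def checkForm (sl : List (List ℕ)) (L : List Pair) (p : Pair) : Bool :=
  let P := closure sl 100 [p] []
  cell sl p.2.1 p.2.2.1 p.2.2.2 && (memPair p P &&
    (isClosed sl P && P.all fun q => eqPair q p || !memPair q L))

/-- The normal forms are a basis dual to the homomorphisms attached to their closures. -/
def checkForms (sl : List (List ℕ)) : Bool :=
  nodupPair (forms sl) && (forms sl).all (checkForm sl (forms sl))

theorem eqPair_eq_true {p q : Pair} : eqPair p q = true ↔ p = q := by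
  simp [eqPair, Prod.ext_iff, and_assoc]

theorem memPair_eq_true {p : Pair} {l : List Pair} : memPair p l = true ↔ p ∈ l := by
  simp [memPair, List.any_eq_true, eqPair_eq_true]

theorem nodup_of_nodupPair {l : List Pair} (h : nodupPair l = true) : l.Nodup := by
  induction l with
  | nil => exact List.nodup_nil
  | cons p l ih =>
    rw [nodupPair, Bool.and_eq_true, Bool.not_eq_true', ← Bool.not_eq_true, memPair_eq_true] at h
    exact List.nodup_cons.2 ⟨h.1, ih h.2⟩

theorem ex_injective {a b k i j t : ℕ} (h : ex a b k = ex i j t) : a = i ∧ b = j ∧ k = t :=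
  ⟨DFunLike.congr_fun h 0, DFunLike.congr_fun h 1, DFunLike.congr_fun h 2⟩

theorem exPair_injective : Function.Injective exPair := by
  rintro ⟨⟨a, b, k⟩, ⟨i, j, t⟩⟩ ⟨⟨a', b', k'⟩, ⟨i', j', t'⟩⟩ h
  obtain ⟨rfl, rfl, rfl⟩ := ex_injective (Prod.ext_iff.1 h).1
  obtain ⟨rfl, rfl, rfl⟩ := ex_injective (Prod.ext_iff.1 h).2
  rfl

theorem single_zero_eq (n : ℕ) : (Finsupp.single 0 n : Fin 3 →₀ ℕ) = ex n 0 0 := by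
  ext i; fin_cases i <;> simp
theorem single_one_eq (n : ℕ) : (Finsupp.single 1 n : Fin 3 →₀ ℕ) = ex 0 n 0 := by
  ext i; fin_cases i <;> simp
theorem single_two_eq (n : ℕ) : (Finsupp.single 2 n : Fin 3 →₀ ℕ) = ex 0 0 n := by
  ext i; fin_cases i <;> simp

variable {sl : List (List ℕ)} {I : Ideal (MvPolynomial (Fin 3) ℂ)}

open Classical in
theorem HasShape.closedPairs (h : HasShape I sl) {P : List Pair} (hP : isClosed sl P = true) :
    ClosedPairs I (P.map exPair).toFinset := by
  simp only [isClosed, List.all_eq_true, Bool.and_eq_true, memPair_eq_true] at hP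
  constructor
  · intro e s v hes hs
    rw [List.mem_toFinset, List.mem_map] at hes ⊢
    obtain ⟨⟨⟨a, b, k⟩, ⟨i, j, t⟩⟩, hp, hes⟩ := hes
    obtain ⟨rfl, rfl⟩ := Prod.ext_iff.1 hes
    have hu := (hP _ hp).1
    fin_cases v
    all_goals
      simp only [exPair, Fin.zero_eta, Fin.mk_one, Fin.reduceFinMk, single_zero_eq, single_one_eq,
        single_two_eq, ← ex_add, Nat.add_zero, h.notMem, ← cell_eq_true] at hs ⊢
    · exact ⟨((a + 1, b, k), (i + 1, j, t)), hu _ (by simp [ups, hs]), rfl⟩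
    · exact ⟨((a, b + 1, k), (i, j + 1, t)), hu _ (by simp [ups, hs]), rfl⟩
    · exact ⟨((a, b, k + 1), (i, j, t + 1)), hu _ (by simp [ups, hs]), rfl⟩
  · intro e s v hes he
    rw [List.mem_toFinset, List.mem_map] at hes
    obtain ⟨⟨⟨a, b, k⟩, ⟨i, j, t⟩⟩, hp, hes⟩ := hes
    obtain ⟨h1, rfl⟩ := Prod.ext_iff.1 hes
    have hd := (hP _ hp).2
    rw [← ex_apply e] at h1 he ⊢
    rw [h, ← cell_eq_false] at he
    simp only [exPair] at h1 ⊢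
    simp only [List.mem_toFinset, List.mem_map]
    fin_cases v
    · simp only [Fin.zero_eta, single_zero_eq, ← ex_add, Nat.add_zero] at h1 ⊢
      obtain ⟨rfl, rfl, rfl⟩ := ex_injective h1
      cases i with
      | zero => exact absurd (hd none (by simp [downs, he])) (by simp)
      | succ i => exact ⟨_, ex_add i j t 1 0 0, _,
          memPair_eq_true.1 (hd (some ((e 0, e 1, e 2), (i, j, t))) (by simp [downs, he])), rfl⟩
    · simp only [Fin.mk_one, single_one_eq, ← ex_add, Nat.add_zero] at h1 ⊢
      obtain ⟨rfl, rfl, rfl⟩ := ex_injective h1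
      cases j with
      | zero => exact absurd (hd none (by simp [downs, he])) (by simp)
      | succ j => exact ⟨_, ex_add i j t 0 1 0, _,
          memPair_eq_true.1 (hd (some ((e 0, e 1, e 2), (i, j, t))) (by simp [downs, he])), rfl⟩
    · simp only [Fin.reduceFinMk, single_two_eq, ← ex_add, Nat.add_zero] at h1 ⊢
      obtain ⟨rfl, rfl, rfl⟩ := ex_injective h1
      cases t with
      | zero => exact absurd (hd none (by simp [downs, he])) (by simp)
      | succ t => exact ⟨_, ex_add i j t 0 0 1, _,
          memPair_eq_true.1 (hd (some ((e 0, e 1, e 2), (i, j, t))) (by simp [downs, he])), rfl⟩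

open Classical in
theorem HasShape.tangentDim_eq (h : HasShape I sl) (hI : IsMonomialIdeal I)
    (hsl : checkForms sl = true) : tangentDim I = (forms sl).length := by
  refine le_antisymm (by simpa only [dropKilled] using h.tangentDim_le hI 0) ?_
  rw [checkForms, Bool.and_eq_true, List.all_eq_true] at hsl
  have hnd := nodup_of_nodupPair hsl.1
  have hf : ∀ p ∈ forms sl, ∃ φ, ∀ q ∈ forms sl,
      hcoeff hI (exPair q).1 (exPair q).2 φ = if q = p then 1 else 0 := by
    intro p hp
    have hc := hsl.2 p hp
    simp only [checkForm, Bool.and_eq_true, memPair_eq_true, List.all_eq_true, Bool.or_eq_true,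
      eqPair_eq_true, Bool.not_eq_true', ← Bool.not_eq_true] at hc
    obtain ⟨-, hpP, hcl, huniq⟩ := hc
    refine ⟨pairHom hI (h.closedPairs hcl), fun q hq => ?_⟩
    have hs := hsl.2 q hq
    rw [checkForm, Bool.and_eq_true, cell_eq_true] at hs
    rw [hcoeff_pairHom hI (h.closedPairs hcl) (exPair q).1 (exPair q).2
      ((h _ _ _).2 (len_le_of_mem_forms hq)) ((h.notMem _ _ _).2 hs.1), Prod.mk.eta]
    congr 1
    rw [List.mem_toFinset, List.mem_map_of_injective exPair_injective, eq_iff_iff]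
    refine ⟨fun hqP => (huniq q hqP).resolve_right fun h' => h' hq, ?_⟩
    rintro rfl
    exact hpP
  choose! φ hφ using hf
  rw [← List.length_map (f := exPair)]
  refine length_le_tangentDim hI _ (by simpa only [dropKilled] using h.hom_eq_zero hI 0)
    (fun n => φ ((forms sl).get (n.cast (List.length_map ..)))) fun m n => ?_
  have h1 := hφ _ (List.get_mem (forms sl) (n.cast (List.length_map ..))) _
    (List.get_mem (forms sl) (m.cast (List.length_map ..)))
  simp only [List.get_eq_getElem, List.getElem_map, Fin.val_cast] at h1 ⊢
  rw [h1]
  congr 1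
  rw [hnd.getElem_inj_iff, Fin.ext_iff]

end

theorem length_le_of_mem_succs {s r : List ℕ} (h : r ∈ succs s) : s.length ≤ r.length := by
  induction s generalizing r with
  | nil => simp
  | cons b s ih =>
    obtain ⟨l, hl, h⟩ := List.mem_flatMap.1 h
    have := ih hl
    cases hb : Nat.ble (l.headD 0 + 1) b <;> rw [hb] at h <;> simp at h
    · subst h; simpa using this
    · rcases h with rfl | rfl <;> simpa using this

theorem sum_pos_of_mem_succs {s r : List ℕ} (h : r ∈ succs s) (hr : r ≠ []) : 0 < r.sum := by
  cases s with
  | nil => simp [succs] at h; simp [h.resolve_left hr]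
  | cons b s =>
    obtain ⟨l, hl, h⟩ := List.mem_flatMap.1 h
    cases hb : Nat.ble (l.headD 0 + 1) b with
    | false => rw [hb] at h; simp at h; subst h; simp
    | true =>
      rw [hb] at h
      have := Nat.le_of_ble_eq_true hb
      simp at h
      rcases h with rfl | rfl
      · simp only [List.sum_cons]
        omega
      · simp

/-- Each slice, read from the last one, is a nonempty successor of the next one. -/
def IsChain : List (List ℕ) → Prop
  | [] => True
  | r :: sl => r ∈ succs (sl.headD []) ∧ r ≠ [] ∧ IsChain sl

theorem IsChain.length_le {sl : List (List ℕ)} (h : IsChain sl) :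
    ∀ r ∈ sl, r.length ≤ (sl.headD []).length := by
  induction sl with
  | nil => simp
  | cons s sl ih =>
    intro r hr
    rcases List.mem_cons.1 hr with rfl | hr
    · exact le_rfl
    · exact (ih h.2.2 r hr).trans (length_le_of_mem_succs h.1)

theorem IsChain.of_append {pre sl : List (List ℕ)} (h : IsChain (pre ++ sl)) : IsChain sl := by
  induction pre with
  | nil => exact h
  | cons r pre ih => exact ih h.2.2

theorem sum_mul_length_le {m : ℕ} {sl : List (List ℕ)} (h : ∀ r ∈ sl, r.length ≤ m) :
    (sl.map fun r => r.sum * r.length).sum ≤ m * (sl.map List.sum).sum := by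
  induction sl with
  | nil => simp
  | cons r sl ih =>
    rw [List.forall_mem_cons] at h
    simp only [List.map_cons, List.sum_cons, mul_add]
    exact add_le_add (by rw [mul_comm]; exact Nat.mul_le_mul_right _ h.1) (ih h.2)

theorem search_sound {m thr f : ℕ} {sl : List (List ℕ)} {tot acc : ℕ}
    (h : search m thr f sl tot acc = true)
    (htot : tot = (sl.map List.sum).sum) (hacc : acc = (sl.map fun r => r.sum * r.length).sum)
    (pre : List (List ℕ)) (hch : IsChain (pre ++ sl)) (h35 : ((pre ++ sl).map List.sum).sum = 35)
    (hm : ((pre ++ sl).headD []).length = m) :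
    ∃ n, (dropKilled (pre ++ sl) n (forms (pre ++ sl))).length ≤ thr := by
  induction f generalizing sl tot acc pre with
  | zero => simp [search] at h
  | succ f ih =>
    have hlen := hm ▸ hch.length_le
    have h35' := h35
    rw [List.map_append, List.sum_append, ← htot] at h35'
    have hhead : (sl.headD []).length ≤ m := by
      cases sl with
      | nil => simp
      | cons r sl => exact hlen r (by simp)
    simp only [search, Bool.or_eq_true, Nat.ble_eq] at h
    rcases h with h | h | h | h
    · refine ⟨0, ?_⟩
      rw [dropKilled, length_forms, h35, List.map_append, List.sum_append, ← hacc]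
      have := sum_mul_length_le (sl := pre) (m := m) fun r hr => hlen r (List.mem_append_left _ hr)
      have e : 35 - tot = (pre.map List.sum).sum := by omega
      rw [e] at h
      omega
    · omega
    · omega
    · rcases List.eq_nil_or_concat pre with rfl | ⟨pre, r, rfl⟩
      · have : Nat.beq tot 35 = true := by rw [Nat.beq_eq]; simpa using h35'
        rw [this, cond_true, Bool.or_eq_true, Bool.not_eq_true'] at h
        rcases h with h | h
        · rw [List.nil_append] at hm
          rw [hm, ← Bool.not_eq_true, Nat.beq_eq] at h
          exact absurd rfl h
        · refine ⟨35 + 2 * acc - thr, ?_⟩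
          have hd := length_dropKilled _ _ _ h
          rw [length_forms, ← hacc, ← htot, Nat.eq_of_beq_eq_true this] at hd
          rw [List.nil_append]
          omega
      · rw [List.concat_eq_append, List.append_assoc, List.singleton_append] at *
        have hr := hch.of_append
        have hpos := sum_pos_of_mem_succs hr.1 hr.2.1
        have : Nat.beq tot 35 = false := by
          rw [← Bool.not_eq_true, Nat.beq_eq]
          simp at h35'
          omega
        rw [this, cond_false, List.all_eq_true] at h
        have h' := h r hr.1
        rw [Bool.or_eq_true] at h'
        refine ih (h'.resolve_left fun h => hr.2.1 (List.isEmpty_iff.1 h)) ?_ ?_ pre hch h35 hm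
        · rw [htot, List.map_cons, List.sum_cons, add_comm]
        · rw [hacc, List.map_cons, List.sum_cons, add_comm]

section

variable {sl : List (List ℕ)} {I : Ideal (MvPolynomial (Fin 3) ℂ)}

theorem sum_range_getD {α : Type*} (l : List α) (d : α) (f : α → ℕ) :
    ∑ k ∈ Finset.range l.length, f (l.getD k d) = (l.map f).sum :=
  congrArg List.sum (map_range_getD l d f)

theorem HasShape.finrank_eq (h : HasShape I sl) (hI : IsMonomialIdeal I) :
    Module.finrank ℂ (MvPolynomial (Fin 3) ℂ ⧸ I) = (sl.map List.sum).sum := by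
  classical
  let T : Finset (Σ _ : ℕ, Σ _ : ℕ, ℕ) := (Finset.range sl.length).sigma fun k =>
    (Finset.range (sl.getD k []).length).sigma fun i => Finset.range (len sl k i)
  have hT : T.card = (sl.map List.sum).sum := by
    simp only [T, Finset.card_sigma, Finset.card_range, len]
    rw [← sum_range_getD sl [] List.sum]
    refine Finset.sum_congr rfl fun k _ => ?_
    rw [sum_range_getD _ 0 fun x => x, List.map_id']
  rw [finrank_quotient hI, ← hT,
    ← Finset.card_image_of_injective (f := fun x => ex x.2.1 x.2.2 x.1) T ?_]
  · refine Nat.subtype_card _ fun d => ?_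
    conv_rhs => rw [← ex_apply d, h.notMem]
    simp only [T, Finset.mem_image, Finset.mem_sigma, Finset.mem_range]
    constructor
    · rintro ⟨x, ⟨-, -, h⟩, rfl⟩
      exact h
    · intro hd
      exact ⟨⟨d 2, d 0, d 1⟩, ⟨lt_length_of_lt_len hd, lt_length_row hd, hd⟩, ex_apply d⟩
  · rintro ⟨k, i, j⟩ ⟨k', i', j'⟩ h
    obtain ⟨rfl, rfl, rfl⟩ := ex_injective h
    rfl

/-- The conditions on the cells for the ideal to be Borel-fixed. -/
def IsBorelShape (sl : List (List ℕ)) : Prop :=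
  ∀ k i, len sl k (i + 1) ≤ len sl k i - 1 ∧ len sl k (i + 1) ≤ len sl (k + 1) i ∧
    len sl k i ≤ len sl (k + 1) i + 1 ∧ len sl (k + 1) i ≤ len sl k i

theorem len_eq_zero_of_length_le {N k i : ℕ} (hsl : sl.length ≤ N) (hr : ∀ r ∈ sl, r.length ≤ N)
    (h : N ≤ k ∨ N ≤ i) : len sl k i = 0 := by
  by_contra h0
  have h1 := lt_length_of_lt_len (Nat.pos_of_ne_zero h0)
  have h2 := lt_length_row (Nat.pos_of_ne_zero h0)
  rw [List.getD_eq_getElem _ _ h1] at h2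
  have := hr _ (List.getElem_mem h1)
  omega

theorem IsBorelShape.of_bounded {N : ℕ} (hsl : sl.length ≤ N) (hr : ∀ r ∈ sl, r.length ≤ N)
    (h : ∀ k < N, ∀ i < N, len sl k (i + 1) ≤ len sl k i - 1 ∧ len sl k (i + 1) ≤ len sl (k + 1) i ∧
      len sl k i ≤ len sl (k + 1) i + 1 ∧ len sl (k + 1) i ≤ len sl k i) : IsBorelShape sl := by
  intro k i
  by_cases hki : N ≤ k ∨ N ≤ i
  · rw [len_eq_zero_of_length_le hsl hr hki,
      len_eq_zero_of_length_le (k := k + 1) hsl hr (by omega),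
      len_eq_zero_of_length_le (i := i + 1) hsl hr (by omega)]
    omega
  · exact h k (by omega) i (by omega)

theorem IsBorelShape.antitone (h : IsBorelShape sl) : Antitone₂ sl := by
  intro k k' i i' hk hi
  exact (antitone_nat_of_succ_le (f := fun k => len sl k i') (fun k => (h k i').2.2.2) hk).trans
    (antitone_nat_of_succ_le (f := len sl k) (fun i => (h k i).1.trans (Nat.sub_le _ _)) hi)

/-- The monomial ideal whose standard monomials are the cells of `sl`. -/
noncomputable def shapeIdeal (sl : List (List ℕ)) : Ideal (MvPolynomial (Fin 3) ℂ) :=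
  Ideal.span ((fun d => monomial d (1 : ℂ)) '' {d | len sl (d 2) (d 0) ≤ d 1})

theorem isMonomialIdeal_shapeIdeal (sl : List (List ℕ)) : IsMonomialIdeal (shapeIdeal sl) := by
  intro p hp d hd
  rw [shapeIdeal, mem_ideal_span_monomial_image] at hp ⊢
  intro e he
  rw [support_monomial, if_neg one_ne_zero, Finset.mem_singleton] at he
  exact he ▸ hp d hd

theorem hasShape_shapeIdeal (h : Antitone₂ sl) : HasShape (shapeIdeal sl) sl := by
  intro a b k
  rw [shapeIdeal, mem_ideal_span_monomial_image, support_monomial, if_neg one_ne_zero]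
  simp only [Finset.mem_singleton, forall_eq, Set.mem_ofPred_eq]
  constructor
  · rintro ⟨d, hd, hle⟩
    rw [le_iff_ex] at hle
    exact ((h _ _ _ _ hle.2.2 hle.1).trans hd).trans hle.2.1
  · exact fun hab => ⟨_, hab, le_rfl⟩

theorem HasShape.isBorelFixed (h : HasShape I sl) (hsl : IsBorelShape sl) : IsBorelFixed I := by
  intro d hd i j hij hj
  obtain ⟨e, rfl⟩ : ∃ e, d = e + Finsupp.single j 1 :=
    ⟨d - Finsupp.single j 1, (tsub_add_cancel_of_le (Finsupp.single_le_iff.2 hj)).symm⟩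
  rw [add_right_comm, add_tsub_cancel_right]
  rw [← ex_apply e] at hd ⊢
  fin_cases i <;> fin_cases j <;> try exact absurd hij (by decide)
  all_goals
    simp only [Fin.zero_eta, Fin.mk_one, Fin.reduceFinMk, single_zero_eq, single_one_eq,
      single_two_eq, ← ex_add, Nat.add_zero, h _ _ _] at hd ⊢
    have h1 := hsl (e 2) (e 0)
    omega

theorem HasShape.isBorelShape (h : HasShape I sl) (hI : IsBorelFixed I) : IsBorelShape sl := by
  have key : ∀ (e : Fin 3 →₀ ℕ) (i j : Fin 3), i < j →
      monomial (e + Finsupp.single j 1) (1 : ℂ) ∈ I →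
      monomial (e + Finsupp.single i 1) (1 : ℂ) ∈ I := fun e i j hij he => by
    have := hI _ he i j hij (by simp)
    rwa [add_right_comm, add_tsub_cancel_right] at this
  intro k i
  refine ⟨?_, ?_, ?_, h.antitone _ _ _ _ (Nat.le_succ k) le_rfl⟩
  · have := key (ex i (len sl k i - 1) k) 0 1 (by decide)
    simp only [single_zero_eq, single_one_eq, ← ex_add, Nat.add_zero, h _ _ _] at this
    exact this (by omega)
  · have := key (ex i (len sl (k + 1) i) k) 0 2 (by decide)
    simp only [single_zero_eq, single_two_eq, ← ex_add, Nat.add_zero, h _ _ _] at this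
    exact this le_rfl
  · have := key (ex i (len sl (k + 1) i) k) 1 2 (by decide)
    simp only [single_one_eq, single_two_eq, ← ex_add, Nat.add_zero, h _ _ _] at this
    exact this le_rfl

/-- No slice is empty and no row is empty. -/
def IsProper (sl : List (List ℕ)) : Prop := ∀ r ∈ sl, r ≠ [] ∧ ∀ x ∈ r, x ≠ 0

theorem mem_succs {r s : List ℕ} (hr : ∀ x ∈ r, x ≠ 0) (hs : ∀ x ∈ s, x ≠ 0)
    (h : ∀ i, r.getD (i + 1) 0 ≤ r.getD i 0 - 1 ∧ r.getD (i + 1) 0 ≤ s.getD i 0 ∧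
      r.getD i 0 ≤ s.getD i 0 + 1 ∧ s.getD i 0 ≤ r.getD i 0) : r ∈ succs s := by
  induction s generalizing r with
  | nil =>
    cases r with
    | nil => simp [succs]
    | cons c r =>
      have h0 := h 0
      have hc := hr c (by simp)
      cases r with
      | nil =>
        simp at h0
        have : c = 1 := by omega
        simp [succs, this]
      | cons c' r =>
        simp at h0
        have := hr c' (by simp)
        omega
  | cons b s ih =>
    have h0 := h 0
    have hb := hs b (by simp)
    cases r with
    | nil => simp at h0; omega
    | cons c r =>
      rw [List.forall_mem_cons] at hr hs
      refine List.mem_flatMap.2 ⟨r, ih hr.2 hs.2 fun i => h (i + 1), ?_⟩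
      have e : (c :: r).getD (0 + 1) 0 = r.headD 0 := by cases r <;> rfl
      rw [e] at h0
      simp only [List.getD_cons_zero] at h0
      cases hh : Nat.ble (r.headD 0 + 1) b with
      | false =>
        have : ¬ r.headD 0 + 1 ≤ b := fun h' => by
          rw [Nat.ble_eq_true_of_le h'] at hh
          cases hh
        have : c = b + 1 := by omega
        simp [this]
      | true =>
        have : c = b ∨ c = b + 1 := by omega
        simpa using this

theorem IsBorelShape.isChain (h : IsBorelShape sl) (hsl : IsProper sl) : IsChain sl := by
  induction sl with
  | nil => trivial
  | cons r sl ih =>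
    have hsl' := List.forall_mem_cons.1 hsl
    refine ⟨mem_succs hsl'.1.2 ?_ fun i => ?_, hsl'.1.1, ih (fun k i => h (k + 1) i) hsl'.2⟩
    · cases sl with
      | nil => simp
      | cons s sl => exact (hsl'.2 s (by simp)).2
    · have := h 0 i
      cases sl <;> exact this

theorem exists_list_getD {α : Type*} (d : α) (N : ℕ) (f : ℕ → α) (hN : ∀ i, N ≤ i → f i = d)
    (hf : ∀ i, f i = d → f (i + 1) = d) :
    ∃ l : List α, (∀ x ∈ l, x ≠ d) ∧ ∀ i, l.getD i d = f i := by
  induction N generalizing f with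
  | zero => exact ⟨[], by simp, fun i => by rw [hN i (Nat.zero_le i)]; rfl⟩
  | succ N ih =>
    by_cases h0 : f 0 = d
    · refine ⟨[], by simp, fun i => ?_⟩
      induction i with
      | zero => exact h0.symm
      | succ i hi => exact (hf i hi.symm).symm
    · obtain ⟨l, h1, h2⟩ := ih (fun i => f (i + 1)) (fun i hi => hN _ (by omega))
        fun i => hf (i + 1)
      refine ⟨f 0 :: l, List.forall_mem_cons.2 ⟨h0, h1⟩, fun i => ?_⟩
      cases i with
      | zero => rfl
      | succ i => exact h2 i

theorem exists_hasShape (hI : IsMonomialIdeal I)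
    (h : Module.finrank ℂ (MvPolynomial (Fin 3) ℂ ⧸ I) ≠ 0) :
    ∃ sl, IsProper sl ∧ HasShape I sl := by
  classical
  rw [finrank_quotient hI] at h
  have : Finite {s : Fin 3 →₀ ℕ | monomial s (1 : ℂ) ∉ I} := Nat.finite_of_card_ne_zero h
  have hfin := Set.toFinite {s : Fin 3 →₀ ℕ | monomial s (1 : ℂ) ∉ I}
  obtain ⟨u, hu⟩ := hfin.bddAbove
  have hbd : ∀ a b k, u 0 < a ∨ u 1 < b ∨ u 2 < k → monomial (ex a b k) (1 : ℂ) ∈ I := by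
    intro a b k hlt
    by_contra hn
    have := le_iff_ex.1 (hu hn)
    simp only [ex_zero, ex_one, ex_two] at this
    omega
  have hex : ∀ k i, ∃ j, monomial (ex i j k) (1 : ℂ) ∈ I := fun k i =>
    ⟨u 1 + 1, hbd _ _ _ (by omega)⟩
  have hmem : ∀ a b k, monomial (ex a b k) (1 : ℂ) ∈ I ↔ Nat.find (hex k a) ≤ b := by
    intro a b k
    refine ⟨fun h => Nat.find_min' _ h, fun h => ?_⟩
    obtain ⟨v, rfl⟩ := Nat.exists_eq_add_of_le h
    have := mem_add (Nat.find_spec (hex k a)) (ex 0 v 0)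
    rwa [← ex_add] at this
  have hstep : ∀ a b k a' k', a ≤ a' → k ≤ k' → monomial (ex a b k) (1 : ℂ) ∈ I →
      monomial (ex a' b k') (1 : ℂ) ∈ I := by
    intro a b k a' k' ha hk h
    obtain ⟨v, rfl⟩ := Nat.exists_eq_add_of_le ha
    obtain ⟨w, rfl⟩ := Nat.exists_eq_add_of_le hk
    have := mem_add h (ex v 0 w)
    rwa [← ex_add] at this
  have hz : ∀ k i, Nat.find (hex k i) = 0 ↔ monomial (ex i 0 k) (1 : ℂ) ∈ I := fun k i => by
    rw [hmem, Nat.le_zero]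
  have hrow : ∀ k, ∃ r : List ℕ, (∀ x ∈ r, x ≠ 0) ∧ ∀ i, r.getD i 0 = Nat.find (hex k i) := by
    intro k
    refine exists_list_getD 0 (u 0 + 1) _ (fun i hi => ?_) fun i hi => ?_
    · rw [hz]
      exact hbd _ _ _ (by omega)
    · rw [hz] at hi ⊢
      exact hstep _ _ _ _ _ (Nat.le_succ i) le_rfl hi
  choose row hpos hlen using hrow
  have hnil : ∀ k, row k = [] ↔ monomial (ex 0 0 k) (1 : ℂ) ∈ I := by
    intro k
    rw [← hz, ← hlen]
    cases hr : row k with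
    | nil => simp
    | cons x r => simpa using hpos k x (by simp [hr])
  obtain ⟨sl, h1, h2⟩ := exists_list_getD [] (u 2 + 1) row
    (fun k hk => (hnil k).2 (hbd _ _ _ (by omega)))
    fun k hk => (hnil _).2 (hstep _ _ _ _ _ le_rfl (Nat.le_succ k) ((hnil k).1 hk))
  refine ⟨sl, fun r hr => ⟨h1 r hr, ?_⟩, fun a b k => ?_⟩
  · obtain ⟨k, hk, rfl⟩ := List.getElem_of_mem hr
    rw [← List.getD_eq_getElem _ [] hk, h2]
    exact hpos k
  · rw [hmem, len, h2, hlen]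

theorem X_zero_pow_eq (m : ℕ) : (X 0 : MvPolynomial (Fin 3) ℂ) ^ m = monomial (ex m 0 0) 1 := by
  rw [X_pow_eq_monomial, single_zero_eq]

theorem IsProper.length_head (hsl : IsProper sl) (h : HasShape I sl) (m : ℕ) :
    (X 0 : MvPolynomial (Fin 3) ℂ) ^ m ∈ I ↔ (sl.headD []).length ≤ m := by
  rw [X_zero_pow_eq, h]
  cases sl with
  | nil => simp [len]
  | cons r sl =>
    simp only [len, List.getD_cons_zero, List.headD_cons, Nat.le_zero]
    refine ⟨fun h0 => ?_, fun hm => List.getD_eq_default _ _ hm⟩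
    by_contra hm
    rw [List.getD_eq_getElem _ _ (not_le.1 hm)] at h0
    exact (hsl r (by simp)).2 _ (List.getElem_mem (not_le.1 hm)) h0

end

theorem tangentDim_le_of_search {m T : ℕ} (h : search m T 37 [] 0 0 = true)
    {I : Ideal (MvPolynomial (Fin 3) ℂ)} (hI : IsMonomialIdeal I) (hB : IsBorelFixed I)
    (h35 : Module.finrank ℂ (MvPolynomial (Fin 3) ℂ ⧸ I) = 35)
    (h1 : (X 0 : MvPolynomial (Fin 3) ℂ) ^ m ∈ I)
    (h2 : (X 0 : MvPolynomial (Fin 3) ℂ) ^ (m - 1) ∉ I) : tangentDim I ≤ T := by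
  obtain ⟨sl, hsl, hS⟩ := exists_hasShape hI (by rw [h35]; decide)
  rw [hsl.length_head hS] at h1 h2
  have hch := (hS.isBorelShape hB).isChain hsl
  rw [hS.finrank_eq hI] at h35
  rw [← List.append_nil sl] at hch h35
  obtain ⟨n, hn⟩ := search_sound h rfl rfl sl hch h35 (by rw [List.append_nil]; omega)
  rw [List.append_nil] at hn
  exact (hS.tangentDim_le hI n).trans hn

theorem tmaxEq_of_check {m T : ℕ} (h : search m T 37 [] 0 0 = true) (hm : m ≠ 0)
    {sl : List (List ℕ)} (hB : IsBorelShape sl) (hsl : IsProper sl)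
    (h35 : (sl.map List.sum).sum = 35) (hh : (sl.headD []).length = m)
    (hc : checkForms sl = true) (hT : (forms sl).length = T) : TmaxEq 35 m T := by
  have hI := isMonomialIdeal_shapeIdeal sl
  have hS := hasShape_shapeIdeal hB.antitone
  refine ⟨⟨shapeIdeal sl, hI, hS.isBorelFixed hB, ?_, ?_, ?_, ?_⟩, ?_⟩
  · rw [hS.finrank_eq hI, h35]
  · rw [hsl.length_head hS, hh]
  · rw [hsl.length_head hS, hh]
    omega
  · rw [hS.tangentDim_eq hI hc, hT]
  · rintro _ ⟨J, hJ, hJB, hJ35, hJ1, hJ2, rfl⟩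
    exact tangentDim_le_of_search h hJ hJB hJ35 hJ1 hJ2

instance (sl : List (List ℕ)) : Decidable (IsProper sl) :=
  inferInstanceAs (Decidable (∀ r ∈ sl, r ≠ [] ∧ ∀ x ∈ r, x ≠ 0))

/-- The slices of `𝔪 ^ 5`. -/
def powShape : List (List ℕ) := [[5, 4, 3, 2, 1], [4, 3, 2, 1], [3, 2, 1], [2, 1], [1]]

set_option maxRecDepth 100000 in
theorem checkForms_powShape : checkForms powShape = true := by decide +kernel

theorem isMonomialIdeal_pow (n : ℕ) :
    IsMonomialIdeal (Ideal.span (Set.range (X : Fin 3 → MvPolynomial (Fin 3) ℂ)) ^ n) := by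
  change IsMonomialIdeal (idealOfVars (Fin 3) ℂ ^ n)
  intro p hp d hd
  rw [mem_pow_idealOfVars_iff] at hp
  exact (monomial_mem_pow_idealOfVars_iff n d one_ne_zero).2 (hp d hd)

theorem hasShape_pow_five :
    HasShape (Ideal.span (Set.range (X : Fin 3 → MvPolynomial (Fin 3) ℂ)) ^ 5) powShape := by
  intro a b k
  have hlen : len powShape k a = 5 - (k + a) := by
    by_cases h : 5 ≤ k ∨ 5 ≤ a
    · rw [len_eq_zero_of_length_le (N := 5) (by decide) (by decide) h]
      omega
    · have : ∀ k < 5, ∀ a < 5, len powShape k a = 5 - (k + a) := by decide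
      exact this k (by omega) a (by omega)
  have := monomial_mem_pow_idealOfVars_iff (R := ℂ) 5 (ex a b k) one_ne_zero
  rw [Finsupp.degree_eq_sum, Fin.sum_univ_three] at this
  rw [hlen]
  refine this.trans ?_
  simp only [ex_zero, ex_one, ex_two]
  omega

set_option maxRecDepth 100000 in
set_option maxHeartbeats 1000000 in
theorem search_two : search 2 169 37 [] 0 0 = true := by decide +kernel

set_option maxRecDepth 100000 in
theorem tmaxEq_two : TmaxEq 35 2 169 :=
  tmaxEq_of_check (sl := [[6, 4], [5, 3], [4, 2], [3, 2], [2, 1], [2], [1]])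
    search_two (by decide) (.of_bounded (N := 7) (by decide) (by decide) (by decide))
    (by decide) (by decide) (by decide) (by decide +kernel) (by decide +kernel)

set_option maxRecDepth 100000 in
theorem tmaxEq_three : TmaxEq 35 3 225 :=
  tmaxEq_of_check (sl := [[5, 4, 3], [4, 3, 2], [3, 2, 1], [2, 1], [2, 1], [1], [1]])
    (by decide +kernel) (by decide) (.of_bounded (N := 7) (by decide) (by decide) (by decide))
    (by decide) (by decide) (by decide) (by decide +kernel) (by decide +kernel)

set_option maxRecDepth 100000 in
theorem tmaxEq_four : TmaxEq 35 4 279 :=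
  tmaxEq_of_check (sl := [[5, 4, 3, 2], [4, 3, 2, 1], [3, 2, 1], [2, 1], [1], [1]])
    (by decide +kernel) (by decide) (.of_bounded (N := 6) (by decide) (by decide) (by decide))
    (by decide) (by decide) (by decide) (by decide +kernel) (by decide +kernel)

set_option maxRecDepth 100000 in
theorem tmaxEq_five : TmaxEq 35 5 315 :=
  tmaxEq_of_check (sl := powShape)
    (by decide +kernel) (by decide) (.of_bounded (N := 5) (by decide) (by decide) (by decide))
    (by decide) (by decide) (by decide) checkForms_powShape (by decide +kernel)

theorem le_of_tmaxEq_one {T : ℕ} (h : TmaxEq 35 1 T) : T ≤ 105 := by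
  obtain ⟨I, hI, hB, h35, h1, h2, rfl⟩ := h.1
  exact tangentDim_le_of_search (by decide +kernel) hI hB h35 h1 h2

end BorelTangent

theorem Tmax_monotonicity_l35 :
    TmaxEq 35 2 169 ∧
    TmaxEq 35 3 225 ∧
    TmaxEq 35 4 279 ∧
    TmaxEq 35 5 315 ∧
    (∀ T1 T2 T3 T4 T5 : ℕ, TmaxEq 35 1 T1 → TmaxEq 35 2 T2 → TmaxEq 35 3 T3 → TmaxEq 35 4 T4 → TmaxEq 35 5 T5 →
      T1 < T2 ∧ T2 < T3 ∧ T3 < T4 ∧ T4 < T5) ∧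
    Module.finrank ℂ (MvPolynomial (Fin 3) ℂ ⧸
      ((Ideal.span (Set.range (X : Fin 3 → MvPolynomial (Fin 3) ℂ))) ^ 5)) = 35 ∧
    (35 : ℕ) = Nat.choose 7 3 ∧
    tangentDim ((Ideal.span (Set.range (X : Fin 3 → MvPolynomial (Fin 3) ℂ))) ^ 5) = 315 := by
  open BorelTangent in
  refine ⟨tmaxEq_two, tmaxEq_three, tmaxEq_four, tmaxEq_five, ?_, ?_, by decide, ?_⟩
  · intro T1 T2 T3 T4 T5 h1 h2 h3 h4 h5
    have h1 := le_of_tmaxEq_one h1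
    obtain rfl := h2.unique tmaxEq_two
    obtain rfl := h3.unique tmaxEq_three
    obtain rfl := h4.unique tmaxEq_four
    obtain rfl := h5.unique tmaxEq_five
    omega
  · rw [hasShape_pow_five.finrank_eq (isMonomialIdeal_pow 5)]
    decide
  · rw [hasShape_pow_five.tangentDim_eq (isMonomialIdeal_pow 5) checkForms_powShape]
    decide +kernel
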